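/- arXiv:2208.13532 — 11 statements merged into one kernel-verified Lean document; each statement's English description precedes it below -/
import Mathlib

section
/- Let n, μ, h, h_c > 0 with h ≤ n, let σ² ≥ 0, set l = min(μn/h, h_c), and assume μ < l and μ² + σ² ≤ μl. Then the discrete measure P* placing mass σ²/(lμ) at 0, mass σ²/(l(l−μ)) at l, and mass 1 − σ²/(lμ) − σ²/(l(l−μ)) at μ is a probability measure supported in [0, h_c] with mean μ and second moment μ² + σ², and it satisfies a_{P*}(h) = (n/h)·∫ x·min(hx/(μn), 1) dP*(x) = (μ²+σ²)/μ. -/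
open MeasureTheory

theorem integral_three_dirac {a b c : ℝ} (ha : 0 ≤ a) (hb : 0 ≤ b) (hc : 0 ≤ c) (x y z : ℝ)
    (f : ℝ → ℝ) :
    ∫ t, f t ∂(ENNReal.ofReal a • Measure.dirac x + ENNReal.ofReal b • Measure.dirac y
      + ENNReal.ofReal c • Measure.dirac z) = a * f x + b * f y + c * f z := by
  have hf (r w : ℝ) : Integrable f (ENNReal.ofReal r • Measure.dirac w) :=
    (integrable_dirac (by simp)).smul_measure ENNReal.ofReal_ne_top
  rw [integral_add_measure ((hf a x).add_measure (hf b y)) (hf c z),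
    integral_add_measure (hf a x) (hf b y)]
  simp [integral_smul_measure, ENNReal.toReal_ofReal, ha, hb, hc]

/-- The three-point distribution with mass `σ²/(lμ)` at `0`,
mass `σ²/(l(l−μ))` at `l = min(μn/h, h_c)`, and remaining mass at `μ` is a probability
measure supported in `[0, h_c]` with mean `μ` and second moment `μ² + σ²`, and it
attains `a_P(h) = (μ² + σ²)/μ`. -/
theorem three_point_attains_annd_variance
    (n μ h h_c σ2 l : ℝ) (hn : 0 < n) (hμ : 0 < μ) (hh : 0 < h) (hhc : 0 < h_c)
    (hhn : h ≤ n) (hσ2 : 0 ≤ σ2)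
    (hl : l = min (μ * n / h) h_c)
    (hμl : μ < l) (hmom : μ ^ 2 + σ2 ≤ μ * l)
    (P : Measure ℝ)
    (hP : P = ENNReal.ofReal (σ2 / (l * μ)) • Measure.dirac (0 : ℝ)
        + ENNReal.ofReal (σ2 / (l * (l - μ))) • Measure.dirac l
        + ENNReal.ofReal (1 - σ2 / (l * μ) - σ2 / (l * (l - μ))) • Measure.dirac μ) :
    IsProbabilityMeasure P ∧
    P (Set.Icc 0 h_c)ᶜ = 0 ∧
    (∫ x, x ∂P) = μ ∧
    (∫ x, x ^ 2 ∂P) = μ ^ 2 + σ2 ∧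
    (n / h) * ∫ x, x * min (h * x / (μ * n)) 1 ∂P = (μ ^ 2 + σ2) / μ := by
  have hl0 : 0 < l := hμ.trans hμl
  have hlμ : 0 < l - μ := sub_pos.2 hμl
  have hlc : l ≤ h_c := hl ▸ min_le_right _ _
  have hln : l ≤ μ * n / h := hl ▸ min_le_left _ _
  have hμn : 0 < μ * n := mul_pos hμ hn
  have ha : 0 ≤ σ2 / (l * μ) := by positivity
  have hb : 0 ≤ σ2 / (l * (l - μ)) := by positivity
  have hc : 0 ≤ 1 - σ2 / (l * μ) - σ2 / (l * (l - μ)) := by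
    have key : 1 - σ2 / (l * μ) - σ2 / (l * (l - μ))
        = (μ * l - (μ ^ 2 + σ2)) / (μ * (l - μ)) := by
      field_simp
      ring
    rw [key]
    exact div_nonneg (sub_nonneg.2 hmom) (by positivity)
  have hmin {x : ℝ} (hx : x ≤ l) : min (h * x / (μ * n)) 1 = h * x / (μ * n) := by
    refine min_eq_left ((div_le_one hμn).2 ?_)
    rw [mul_comm]
    exact (le_div_iff₀ hh).1 (hx.trans hln)
  subst hP
  refine ⟨⟨?_⟩, ?_, ?_, ?_, ?_⟩
  · simp only [Measure.add_apply, Measure.smul_apply, measure_univ, smul_eq_mul, mul_one]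
    rw [← ENNReal.ofReal_add ha hb, ← ENNReal.ofReal_add (by positivity) hc,
      ← ENNReal.ofReal_one]
    congr 1
    ring
  · have hμc : μ ≤ h_c := hμl.le.trans hlc
    simp [measurableSet_Icc.compl, hhc.le, hl0.le, hlc, hμ.le, hμc]
  · rw [integral_three_dirac ha hb hc]
    field_simp
    ring
  · rw [integral_three_dirac ha hb hc]
    field_simp
    ring
  · rw [integral_three_dirac ha hb hc, hmin hl0.le, hmin le_rfl, hmin hμl.le]
    field_simp
    ring
end

section
/- Let n, μ, h, h_c > 0 and σ² ≥ 0 with μ < μn/h ≤ h_c, σ² ≤ μ(h_c − μ), and h ≥ μ²n/(μ²+σ²). Then the supremum of a_P(h) = (n/h)·∫ x·min(hx/(μn), 1) dP(x) over all P in 𝒫(μ,σ²) equals μn/h, and the supremum is attained by some P in 𝒫(μ,σ²) supported on at most three points. -/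
open MeasureTheory

/-- The law on `ℝ` putting mass `p` at `s` and mass `1 - p` at `0`. -/
noncomputable def zeroOrPoint (p s : ℝ) : Measure ℝ :=
  ENNReal.ofReal (1 - p) • Measure.dirac 0 + ENNReal.ofReal p • Measure.dirac s

theorem isProbabilityMeasure_zeroOrPoint {p : ℝ} (hp0 : 0 ≤ p) (hp1 : p ≤ 1) (s : ℝ) :
    IsProbabilityMeasure (zeroOrPoint p s) := by
  constructor
  simp [zeroOrPoint, ← ENNReal.ofReal_add (sub_nonneg.2 hp1) hp0]

theorem zeroOrPoint_apply_eq_zero (p : ℝ) {s : ℝ} {A : Set ℝ} (h0 : (0 : ℝ) ∉ A) (hs : s ∉ A) :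
    zeroOrPoint p s A = 0 := by
  simp [zeroOrPoint, Measure.dirac_apply, h0, hs]

theorem integral_zeroOrPoint {p : ℝ} (hp0 : 0 ≤ p) (hp1 : p ≤ 1) (s : ℝ) (f : ℝ → ℝ) :
    ∫ x, f x ∂zeroOrPoint p s = (1 - p) * f 0 + p * f s := by
  have hInt (c a : ℝ) : Integrable f (ENNReal.ofReal c • Measure.dirac a) :=
    (integrable_dirac (by simp)).smul_measure ENNReal.ofReal_ne_top
  rw [zeroOrPoint, integral_add_measure (hInt _ _) (hInt _ _)]
  simp [integral_smul_measure, ENNReal.toReal_ofReal, hp0, hp1]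

/-- Truncating the integrand `x` by a factor that is at most `1` does not increase the mean
of a law on `[0, ∞)`. -/
theorem integral_mul_min_one_le_integral_id {P : Measure ℝ} (hP : ∀ᵐ x ∂P, 0 ≤ x)
    (hInt : Integrable (fun x : ℝ => x) P) {c : ℝ → ℝ} (hc : ∀ x, 0 ≤ x → 0 ≤ c x) :
    ∫ x, x * min (c x) 1 ∂P ≤ ∫ x, x ∂P := by
  refine integral_mono_of_nonneg ?_ hInt ?_
  · filter_upwards [hP] with x hx
    exact mul_nonneg hx (le_min (hc x hx) zero_le_one)
  · filter_upwards [hP] with x hx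
    exact mul_le_of_le_one_right hx (min_le_right _ _)

/-- When `μ < μn/h ≤ h_c`, `σ² ≤ μ(h_c − μ)` and `h ≥ μ²n/(μ²+σ²)`,
the supremum of `a_P(h)` over all probability measures `P` on `[0, h_c]` with mean `μ`
and second moment `μ² + σ²` equals `μn/h`, attained by a measure supported on at most
three points. -/
theorem robust_annd_sup_high_h
    (n μ h h_c σ2 : ℝ) (hn : 0 < n) (hμ : 0 < μ) (hh : 0 < h) (hhc : 0 < h_c)
    (hσ2 : 0 ≤ σ2)
    (h1 : μ < μ * n / h) (h2 : μ * n / h ≤ h_c)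
    (h3 : σ2 ≤ μ * (h_c - μ)) (h4 : μ ^ 2 * n / (μ ^ 2 + σ2) ≤ h) :
    (∀ P : Measure ℝ, IsProbabilityMeasure P → P (Set.Icc 0 h_c)ᶜ = 0 →
        (∫ x, x ∂P) = μ → (∫ x, x ^ 2 ∂P) = μ ^ 2 + σ2 →
        (n / h) * ∫ x, x * min (h * x / (μ * n)) 1 ∂P ≤ μ * n / h) ∧
    (∃ P : Measure ℝ, IsProbabilityMeasure P ∧ P (Set.Icc 0 h_c)ᶜ = 0 ∧
        (∫ x, x ∂P) = μ ∧ (∫ x, x ^ 2 ∂P) = μ ^ 2 + σ2 ∧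
        (∃ S : Finset ℝ, S.card ≤ 3 ∧ P ((S : Set ℝ))ᶜ = 0) ∧
        (n / h) * ∫ x, x * min (h * x / (μ * n)) 1 ∂P = μ * n / h) := by
  have hmn : 0 < μ * n := mul_pos hμ hn
  constructor
  · intro P _ hP hmean _
    have hInt : Integrable (fun x : ℝ => x) P :=
      Integrable.of_integral_ne_zero (by rw [hmean]; exact hμ.ne')
    have hnonneg : ∀ᵐ x ∂P, 0 ≤ x :=
      (show ∀ᵐ x ∂P, x ∈ Set.Icc 0 h_c from hP).mono fun x hx => hx.1
    have hle : ∫ x, x * min (h * x / (μ * n)) 1 ∂P ≤ μ :=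
      (integral_mul_min_one_le_integral_id hnonneg hInt fun x hx =>
        div_nonneg (mul_nonneg hh.le hx) hmn.le).trans_eq hmean
    calc (n / h) * ∫ x, x * min (h * x / (μ * n)) 1 ∂P ≤ (n / h) * μ := by gcongr
      _ = μ * n / h := by ring
  · have hm : 0 < μ ^ 2 + σ2 := by positivity
    have hp0 : 0 ≤ μ ^ 2 / (μ ^ 2 + σ2) := by positivity
    have hp1 : μ ^ 2 / (μ ^ 2 + σ2) ≤ 1 := (div_le_one hm).2 (by linarith)
    have hs0 : 0 ≤ (μ ^ 2 + σ2) / μ := by positivity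
    have hsc : (μ ^ 2 + σ2) / μ ≤ h_c := by
      rw [div_le_iff₀ hμ]
      linarith
    have hmin : 1 ≤ h * ((μ ^ 2 + σ2) / μ) / (μ * n) := by
      rw [div_le_iff₀ hm] at h4
      rw [one_le_div hmn, ← mul_div_assoc, le_div_iff₀ hμ]
      linarith
    refine ⟨zeroOrPoint (μ ^ 2 / (μ ^ 2 + σ2)) ((μ ^ 2 + σ2) / μ),
      isProbabilityMeasure_zeroOrPoint hp0 hp1 _, ?_, ?_, ?_,
      ⟨{0, (μ ^ 2 + σ2) / μ}, Finset.card_le_two.trans (by norm_num), ?_⟩, ?_⟩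
    · exact zeroOrPoint_apply_eq_zero _ (by simp [hhc.le]) (by simp [hs0, hsc])
    · rw [integral_zeroOrPoint hp0 hp1]
      field_simp
      ring
    · rw [integral_zeroOrPoint hp0 hp1]
      field_simp
      ring
    · exact zeroOrPoint_apply_eq_zero _ (by simp) (by simp)
    · rw [integral_zeroOrPoint hp0 hp1, min_eq_right hmin]
      field_simp
      ring
end

section
/- Let n, μ, h > 0 and σ² ≥ 0, and let X₁, X₂ be independent nonnegative random variables, each with mean μ and second moment μ² + σ². Then the expected local clustering coefficient satisfies c(h) = (n²/h²)·E[ min(X₁X₂/(μn),1)·min(hX₁/(μn),1)·min(hX₂/(μn),1) ] ≤ min( 1 , (μ²+σ²)²/(μ³n) , μn/h² ). -/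
open MeasureTheory ProbabilityTheory

/-- For independent nonnegative random variables `X₁, X₂`, each with mean `μ`
and second moment `μ² + σ²`, the expected local clustering coefficient
`c(h) = (n²/h²) E[min(X₁X₂/(μn),1) min(hX₁/(μn),1) min(hX₂/(μn),1)]` is at most
`min(1, (μ²+σ²)²/(μ³n), μn/h²)`. -/
theorem robust_clustering_variance_bound
    (n μ h σ2 : ℝ) (hn : 0 < n) (hμ : 0 < μ) (hh : 0 < h) (hσ2 : 0 ≤ σ2)
    {Ω : Type*} [MeasureSpace Ω] [IsProbabilityMeasure (ℙ : Measure Ω)]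
    (X1 X2 : Ω → ℝ) (hm1 : Measurable X1) (hm2 : Measurable X2)
    (hpos1 : ∀ ω, 0 ≤ X1 ω) (hpos2 : ∀ ω, 0 ≤ X2 ω)
    (hindep : IndepFun X1 X2)
    (hi1 : Integrable X1) (hi2 : Integrable X2)
    (hi1sq : Integrable (fun ω => X1 ω ^ 2)) (hi2sq : Integrable (fun ω => X2 ω ^ 2))
    (hmean1 : ∫ ω, X1 ω = μ) (hmean2 : ∫ ω, X2 ω = μ)
    (hsq1 : ∫ ω, X1 ω ^ 2 = μ ^ 2 + σ2) (hsq2 : ∫ ω, X2 ω ^ 2 = μ ^ 2 + σ2) :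
    (n ^ 2 / h ^ 2) *
        ∫ ω, min (X1 ω * X2 ω / (μ * n)) 1 * min (h * X1 ω / (μ * n)) 1 *
          min (h * X2 ω / (μ * n)) 1
      ≤ min 1 (min ((μ ^ 2 + σ2) ^ 2 / (μ ^ 3 * n)) (μ * n / h ^ 2)) := by
  have hint : Integrable (fun ω => X1 ω * X2 ω) := hindep.integrable_mul hi1 hi2
  have hmean : ∫ ω, X1 ω * X2 ω = μ * μ := by
    rw [hindep.integral_fun_mul_eq_mul_integral hi1.1 hi2.1, hmean1, hmean2]
  have hindepSq : IndepFun (fun ω => X1 ω ^ 2) (fun ω => X2 ω ^ 2) :=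
    hindep.comp (measurable_id.pow_const 2) (measurable_id.pow_const 2)
  have hintSq : Integrable (fun ω => X1 ω ^ 2 * X2 ω ^ 2) :=
    hindepSq.integrable_mul hi1sq hi2sq
  have hsq : ∫ ω, X1 ω ^ 2 * X2 ω ^ 2 = (μ ^ 2 + σ2) * (μ ^ 2 + σ2) := by
    rw [hindepSq.integral_fun_mul_eq_mul_integral hi1sq.1 hi2sq.1, hsq1, hsq2]
  have hfactors (ω : Ω) : 0 ≤ X1 ω * X2 ω / (μ * n) ∧
      0 ≤ h * X1 ω / (μ * n) ∧ 0 ≤ h * X2 ω / (μ * n) := by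
    have := hpos1 ω
    have := hpos2 ω
    exact ⟨by positivity, by positivity, by positivity⟩
  have hnonneg (ω : Ω) : 0 ≤ min (X1 ω * X2 ω / (μ * n)) 1 * min (h * X1 ω / (μ * n)) 1 *
      min (h * X2 ω / (μ * n)) 1 := by
    obtain ⟨ha, hb, hc⟩ := hfactors ω
    positivity
  refine le_min ?_ (le_min ?_ ?_)
  · have hle : ∫ ω, min (X1 ω * X2 ω / (μ * n)) 1 * min (h * X1 ω / (μ * n)) 1 *
        min (h * X2 ω / (μ * n)) 1 ≤ ∫ ω, h ^ 2 / (μ * n) ^ 2 * (X1 ω * X2 ω) := by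
      refine integral_mono_of_nonneg (.of_forall hnonneg) (hint.const_mul _)
        (.of_forall fun ω => ?_)
      obtain ⟨ha, hb, hc⟩ := hfactors ω
      beta_reduce
      calc _ ≤ 1 * (h * X1 ω / (μ * n)) * (h * X2 ω / (μ * n)) := by
            gcongr <;> simp
        _ = _ := by ring
    rw [integral_const_mul, hmean] at hle
    calc _ ≤ n ^ 2 / h ^ 2 * (h ^ 2 / (μ * n) ^ 2 * (μ * μ)) := by gcongr
      _ = 1 := by field_simp
  · have hle : ∫ ω, min (X1 ω * X2 ω / (μ * n)) 1 * min (h * X1 ω / (μ * n)) 1 *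
        min (h * X2 ω / (μ * n)) 1 ≤ ∫ ω, h ^ 2 / (μ * n) ^ 3 * (X1 ω ^ 2 * X2 ω ^ 2) := by
      refine integral_mono_of_nonneg (.of_forall hnonneg) (hintSq.const_mul _)
        (.of_forall fun ω => ?_)
      obtain ⟨ha, hb, hc⟩ := hfactors ω
      beta_reduce
      calc _ ≤ X1 ω * X2 ω / (μ * n) * (h * X1 ω / (μ * n)) * (h * X2 ω / (μ * n)) := by
            gcongr <;> simp
        _ = _ := by ring
    rw [integral_const_mul, hsq] at hle
    calc _ ≤ n ^ 2 / h ^ 2 * (h ^ 2 / (μ * n) ^ 3 * ((μ ^ 2 + σ2) * (μ ^ 2 + σ2))) := by gcongr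
      _ = _ := by field_simp
  · have hle : ∫ ω, min (X1 ω * X2 ω / (μ * n)) 1 * min (h * X1 ω / (μ * n)) 1 *
        min (h * X2 ω / (μ * n)) 1 ≤ ∫ ω, 1 / (μ * n) * (X1 ω * X2 ω) := by
      refine integral_mono_of_nonneg (.of_forall hnonneg) (hint.const_mul _)
        (.of_forall fun ω => ?_)
      obtain ⟨ha, hb, hc⟩ := hfactors ω
      beta_reduce
      calc _ ≤ X1 ω * X2 ω / (μ * n) * 1 * 1 := by
            gcongr <;> simp
        _ = _ := by ring
    rw [integral_const_mul, hmean] at hle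
    calc _ ≤ n ^ 2 / h ^ 2 * (1 / (μ * n) * (μ * μ)) := by gcongr
      _ = _ := by field_simp
end

section
/- Let n, μ, h > 0 with μ ≤ n, 0 < h ≤ √(μn), and 0 ≤ σ² ≤ μ(√(μn) − μ). Let P* be the discrete probability measure placing mass σ²/(√(μn)·μ) at 0, mass σ²/(√(μn)(√(μn)−μ)) at √(μn), and the remaining mass at μ. Then P* has mean μ and second moment μ² + σ², and for X₁, X₂ i.i.d. with law P*, E[ min(X₁X₂/(μn),1)·min(hX₁/(μn),1)·min(hX₂/(μn),1) ] = h²(μ²+σ²)²/(μn)³, so that c_{P*}(h) = (μ²+σ²)²/(μ³n). -/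
open MeasureTheory

/-- The integral of a real function against a combination of three Dirac masses with nonnegative
real weights is the corresponding weighted sum of its values. -/
theorem integral_three_dirac_s4 {p q r : ℝ} (hp : 0 ≤ p) (hq : 0 ≤ q) (hr : 0 ≤ r)
    (a b c : ℝ) (f : ℝ → ℝ) :
    ∫ x, f x ∂(ENNReal.ofReal p • Measure.dirac a + ENNReal.ofReal q • Measure.dirac b
        + ENNReal.ofReal r • Measure.dirac c) = p * f a + q * f b + r * f c := by
  have hint (w y : ℝ) : Integrable f (ENNReal.ofReal w • Measure.dirac y) :=
    (integrable_dirac (by simp)).smul_measure ENNReal.ofReal_ne_top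
  rw [integral_add_measure ((hint p a).add_measure (hint q b)) (hint r c),
    integral_add_measure (hint p a) (hint q b)]
  simp [integral_smul_measure, ENNReal.toReal_ofReal, hp, hq, hr]

/-- For a measure supported on `[0, s]` and `0 ≤ h ≤ s`, no cutoff is active in the triangle
probability with scale `s ^ 2`, so it is a multiple of the squared second moment. -/
theorem integral_triangle_of_ae_mem_Icc {P : Measure ℝ} {s h : ℝ} (hs : 0 < s) (hh : 0 ≤ h)
    (hhs : h ≤ s) (hP : ∀ᵐ x ∂P, x ∈ Set.Icc 0 s) :
    (∫ x, ∫ y, min (x * y / s ^ 2) 1 * min (h * x / s ^ 2) 1 * min (h * y / s ^ 2) 1 ∂P ∂P)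
      = h ^ 2 * (∫ x, x ^ 2 ∂P) ^ 2 / (s ^ 2) ^ 3 := by
  have hmin {x y : ℝ} (hx : x ∈ Set.Icc 0 s) (hy : y ∈ Set.Icc 0 s) :
      min (x * y / s ^ 2) 1 = x * y / s ^ 2 := by
    refine min_eq_left ((div_le_one (by positivity)).2 ?_)
    rw [sq]
    exact mul_le_mul hx.2 hy.2 hy.1 hs.le
  have hinner : (fun x => ∫ y, min (x * y / s ^ 2) 1 * min (h * x / s ^ 2) 1 *
      min (h * y / s ^ 2) 1 ∂P) =ᵐ[P]
        fun x => h ^ 2 / (s ^ 2) ^ 3 * (∫ y, y ^ 2 ∂P) * x ^ 2 := by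
    filter_upwards [hP] with x hx
    calc
      _ = ∫ y, h ^ 2 / (s ^ 2) ^ 3 * x ^ 2 * y ^ 2 ∂P := by
        refine integral_congr_ae ?_
        filter_upwards [hP] with y hy
        rw [hmin hx hy, hmin ⟨hh, hhs⟩ hx, hmin ⟨hh, hhs⟩ hy]
        field_simp
      _ = _ := by
        rw [integral_const_mul]
        ring
  rw [integral_congr_ae hinner, integral_const_mul]
  ring

/-- For `0 < h ≤ √(μn)` and `0 ≤ σ² ≤ μ(√(μn) − μ)`, the three-point
distribution with mass `σ²/(√(μn)μ)` at `0`, mass `σ²/(√(μn)(√(μn)−μ))` at `√(μn)`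
and the remaining mass at `μ` has mean `μ` and second moment `μ² + σ²`, and for
`X₁, X₂` i.i.d. with this law, the triangle probability equals `h²(μ²+σ²)²/(μn)³`,
so that `c_{P*}(h) = (μ²+σ²)²/(μ³n)`. -/
theorem three_point_attains_clustering_low_h
    (n μ h σ2 : ℝ) (hn : 0 < n) (hμ : 0 < μ) (hμn : μ ≤ n)
    (hh : 0 < h) (hhs : h ≤ Real.sqrt (μ * n))
    (hσ2 : 0 ≤ σ2) (hσ2ub : σ2 ≤ μ * (Real.sqrt (μ * n) - μ))
    (P : Measure ℝ)
    (hP : P = ENNReal.ofReal (σ2 / (Real.sqrt (μ * n) * μ)) • Measure.dirac (0 : ℝ)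
        + ENNReal.ofReal (σ2 / (Real.sqrt (μ * n) * (Real.sqrt (μ * n) - μ))) •
            Measure.dirac (Real.sqrt (μ * n))
        + ENNReal.ofReal (1 - σ2 / (Real.sqrt (μ * n) * μ)
            - σ2 / (Real.sqrt (μ * n) * (Real.sqrt (μ * n) - μ))) • Measure.dirac μ) :
    IsProbabilityMeasure P ∧
    (∫ x, x ∂P) = μ ∧
    (∫ x, x ^ 2 ∂P) = μ ^ 2 + σ2 ∧
    (∫ x, ∫ y, min (x * y / (μ * n)) 1 * min (h * x / (μ * n)) 1 *
        min (h * y / (μ * n)) 1 ∂P ∂P)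
      = h ^ 2 * (μ ^ 2 + σ2) ^ 2 / (μ * n) ^ 3 ∧
    (n ^ 2 / h ^ 2) *
        ∫ x, ∫ y, min (x * y / (μ * n)) 1 * min (h * x / (μ * n)) 1 *
          min (h * y / (μ * n)) 1 ∂P ∂P
      = (μ ^ 2 + σ2) ^ 2 / (μ ^ 3 * n) := by
  have hmn : 0 < μ * n := mul_pos hμ hn
  obtain ⟨s, hsdef⟩ : ∃ s, s = Real.sqrt (μ * n) := ⟨_, rfl⟩
  have hs : 0 < s := hsdef ▸ Real.sqrt_pos.2 hmn
  have hs2 : μ * n = s ^ 2 := by rw [hsdef, Real.sq_sqrt hmn.le]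
  have hμs : μ ≤ s := hsdef ▸ Real.le_sqrt_of_sq_le (by nlinarith)
  rw [← hsdef] at hhs hσ2ub hP
  obtain ⟨p, hpdef⟩ : ∃ p, p = σ2 / (s * μ) := ⟨_, rfl⟩
  obtain ⟨q, hqdef⟩ : ∃ q, q = σ2 / (s * (s - μ)) := ⟨_, rfl⟩
  have hsμ : 0 ≤ s - μ := sub_nonneg.2 hμs
  have hp : 0 ≤ p := hpdef ▸ by positivity
  have hq : 0 ≤ q := hqdef ▸ by positivity
  have hpσ : p * μ * s = σ2 := by
    rw [hpdef]
    field_simp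
  have hqσ : q * (s - μ) * s = σ2 ∧ p + q ≤ 1 := by
    rcases hμs.eq_or_lt with heq | hlt
    · have hσ0 : σ2 = 0 := le_antisymm (by simpa [heq] using hσ2ub) hσ2
      simp [hqdef, hpdef, hσ0]
    · have hd : 0 < s - μ := sub_pos.2 hlt
      have hsum : p + q = σ2 / (μ * (s - μ)) := by
        rw [hpdef, hqdef]
        field_simp
        ring
      refine ⟨?_, ?_⟩
      · rw [hqdef]
        field_simp
      · rw [hsum]
        exact (div_le_one (by positivity)).2 hσ2ub
  obtain ⟨hqσ, hpq⟩ := hqσ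
  have hr : 0 ≤ 1 - p - q := by linarith
  rw [← hpdef, ← hqdef] at hP
  have hbal : q * (s - μ) = p * μ := mul_right_cancel₀ hs.ne' (hqσ.trans hpσ.symm)
  have hprob : IsProbabilityMeasure P := by
    constructor
    rw [hP]
    simp only [Measure.add_apply, Measure.smul_apply, measure_univ, smul_eq_mul, mul_one]
    rw [← ENNReal.ofReal_add hp hq, ← ENNReal.ofReal_add (by positivity) hr]
    simp
  have hmean : (∫ x, x ∂P) = μ := by
    rw [hP, integral_three_dirac_s4 hp hq hr 0 s μ (fun x => x)]
    linear_combination hbal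
  have hsecond : (∫ x, x ^ 2 ∂P) = μ ^ 2 + σ2 := by
    rw [hP, integral_three_dirac_s4 hp hq hr 0 s μ (fun x => x ^ 2)]
    linear_combination hqσ + μ * hbal
  have hsupp : ∀ᵐ x ∂P, x ∈ Set.Icc 0 s := by
    rw [hP, ae_add_measure_iff, ae_add_measure_iff]
    refine ⟨⟨Measure.ae_smul_measure ?_ _, Measure.ae_smul_measure ?_ _⟩,
      Measure.ae_smul_measure ?_ _⟩
    · simp [ae_dirac_eq, hs.le]
    · simp [ae_dirac_eq, hs.le]
    · simp [ae_dirac_eq, hμ.le, hμs]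
  have htri := integral_triangle_of_ae_mem_Icc hs hh.le hhs hsupp
  rw [hsecond, ← hs2] at htri
  refine ⟨hprob, hmean, hsecond, htri, ?_⟩
  rw [htri]
  field_simp
end

section
/- Let n, μ > 0 with √(μn) ≤ h ≤ n, μ < μn/h, and 0 ≤ σ² ≤ μ(μn/h − μ). Let P* be the discrete probability measure placing mass σ²/((μn/h)·μ) at 0, mass σ²/((μn/h)(μn/h − μ)) at μn/h, and the remaining mass at μ. Then P* has mean μ and second moment μ² + σ², and for X₁, X₂ i.i.d. with law P*, E[ min(X₁X₂/(μn),1)·min(hX₁/(μn),1)·min(hX₂/(μn),1) ] = h²(μ²+σ²)²/(μn)³, so that c_{P*}(h) = (μ²+σ²)²/(μ³n). -/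
open MeasureTheory

/-- For weights at most `μn/h`, none of the three connection probabilities is truncated. -/
theorem triangle_kernel_eq {n μ h x y : ℝ} (hn : 0 < n) (hμ : 0 < μ)
    (hhs : Real.sqrt (μ * n) ≤ h) (hx : 0 ≤ x) (hxM : x ≤ μ * n / h)
    (hyM : y ≤ μ * n / h) :
    min (x * y / (μ * n)) 1 * min (h * x / (μ * n)) 1 * min (h * y / (μ * n)) 1
      = h ^ 2 / (μ * n) ^ 3 * x ^ 2 * y ^ 2 := by
  have hμn : 0 < μ * n := mul_pos hμ hn
  have hh : 0 < h := (Real.sqrt_pos.mpr hμn).trans_le hhs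
  have hsq : μ * n ≤ h ^ 2 := (Real.sqrt_le_left hh.le).mp hhs
  have hx' : x * h ≤ μ * n := (le_div_iff₀ hh).mp hxM
  have hy' : y * h ≤ μ * n := (le_div_iff₀ hh).mp hyM
  have hyh : y ≤ h := hyM.trans ((div_le_iff₀ hh).mpr (by linarith))
  have hxy : x * y ≤ μ * n := (mul_le_mul_of_nonneg_left hyh hx).trans hx'
  rw [min_eq_left ((div_le_one hμn).mpr hxy), min_eq_left ((div_le_one hμn).mpr (by linarith)),
    min_eq_left ((div_le_one hμn).mpr (by linarith))]
  field_simp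

/-- For `√(μn) ≤ h ≤ n`, `μ < μn/h` and `0 ≤ σ² ≤ μ(μn/h − μ)`, the
three-point distribution with mass `σ²/((μn/h)μ)` at `0`, mass `σ²/((μn/h)(μn/h−μ))`
at `μn/h` and the remaining mass at `μ` has mean `μ` and second moment `μ² + σ²`, and
for `X₁, X₂` i.i.d. with this law, the triangle probability equals
`h²(μ²+σ²)²/(μn)³`, so that `c_{P*}(h) = (μ²+σ²)²/(μ³n)`. -/
theorem three_point_attains_clustering_mid_h
    (n μ h σ2 : ℝ) (hn : 0 < n) (hμ : 0 < μ)
    (hhs : Real.sqrt (μ * n) ≤ h) (hhn : h ≤ n)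
    (hμl : μ < μ * n / h)
    (hσ2 : 0 ≤ σ2) (hσ2ub : σ2 ≤ μ * (μ * n / h - μ))
    (P : Measure ℝ)
    (hP : P = ENNReal.ofReal (σ2 / ((μ * n / h) * μ)) • Measure.dirac (0 : ℝ)
        + ENNReal.ofReal (σ2 / ((μ * n / h) * (μ * n / h - μ))) •
            Measure.dirac (μ * n / h)
        + ENNReal.ofReal (1 - σ2 / ((μ * n / h) * μ)
            - σ2 / ((μ * n / h) * (μ * n / h - μ))) • Measure.dirac μ) :
    IsProbabilityMeasure P ∧
    (∫ x, x ∂P) = μ ∧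
    (∫ x, x ^ 2 ∂P) = μ ^ 2 + σ2 ∧
    (∫ x, ∫ y, min (x * y / (μ * n)) 1 * min (h * x / (μ * n)) 1 *
        min (h * y / (μ * n)) 1 ∂P ∂P)
      = h ^ 2 * (μ ^ 2 + σ2) ^ 2 / (μ * n) ^ 3 ∧
    (n ^ 2 / h ^ 2) *
        ∫ x, ∫ y, min (x * y / (μ * n)) 1 * min (h * x / (μ * n)) 1 *
          min (h * y / (μ * n)) 1 ∂P ∂P
      = (μ ^ 2 + σ2) ^ 2 / (μ ^ 3 * n) := by
  have hμn : 0 < μ * n := mul_pos hμ hn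
  have hh : 0 < h := (Real.sqrt_pos.mpr hμn).trans_le hhs
  have hker := fun x y => triangle_kernel_eq (x := x) (y := y) hn hμ hhs
  set M := μ * n / h with hM
  have hM0 : 0 < M := div_pos hμn hh
  have hd : 0 < M - μ := sub_pos.mpr hμl
  set a := σ2 / (M * μ) with ha_def
  set b := σ2 / (M * (M - μ)) with hb_def
  have ha : 0 ≤ a := by positivity
  have hb : 0 ≤ b := by positivity
  have hab : a + b = σ2 / (μ * (M - μ)) := by
    rw [ha_def, hb_def]
    field_simp
    ring
  have hc : 0 ≤ 1 - a - b := by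
    have : σ2 / (μ * (M - μ)) ≤ 1 := (div_le_one (by positivity)).mpr hσ2ub
    linarith
  have hE : ∀ f : ℝ → ℝ, ∫ t, f t ∂P = a * f 0 + b * f M + (1 - a - b) * f μ := fun f => by
    rw [hP, integral_three_dirac ha hb hc]
  have hmean : a * 0 + b * M + (1 - a - b) * μ = μ := by
    rw [ha_def, hb_def]
    field_simp
    ring
  have hsecond : a * 0 ^ 2 + b * M ^ 2 + (1 - a - b) * μ ^ 2 = μ ^ 2 + σ2 := by
    rw [ha_def, hb_def]
    field_simp
    ring
  have hinner : ∀ x, 0 ≤ x → x ≤ M →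
      ∫ y, min (x * y / (μ * n)) 1 * min (h * x / (μ * n)) 1 * min (h * y / (μ * n)) 1 ∂P
        = h ^ 2 / (μ * n) ^ 3 * x ^ 2 * (μ ^ 2 + σ2) := fun x hx hxM => by
    rw [hE, hker x 0 hx hxM hM0.le, hker x M hx hxM le_rfl,
      hker x μ hx hxM hμl.le, ← hsecond]
    ring
  have htriangle : ∫ x, ∫ y, min (x * y / (μ * n)) 1 * min (h * x / (μ * n)) 1 *
      min (h * y / (μ * n)) 1 ∂P ∂P = h ^ 2 * (μ ^ 2 + σ2) ^ 2 / (μ * n) ^ 3 := by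
    rw [hE, hinner 0 le_rfl hM0.le, hinner M hM0.le le_rfl, hinner μ hμ.le hμl.le]
    linear_combination h ^ 2 / (μ * n) ^ 3 * (μ ^ 2 + σ2) * hsecond
  refine ⟨⟨?_⟩, (hE _).trans hmean, (hE _).trans hsecond, htriangle, ?_⟩
  · rw [hP]
    simp only [Measure.add_apply, Measure.smul_apply, measure_univ, smul_eq_mul, mul_one]
    rw [← ENNReal.ofReal_add ha hb, ← ENNReal.ofReal_add (add_nonneg ha hb) hc,
      ← ENNReal.ofReal_one]
    congr 1
    ring
  · rw [htriangle]
    field_simp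
end

section
/- Let n, μ, h, h_c > 0 with μ ≤ n, h ≤ n, h_c ≥ max(√(μn), μn/h), and let σ² ≥ 0 satisfy σ² < μ·max(√(μn), μn/h) − μ². Then the supremum of c_P(h) = (n²/h²)·E[ min(X₁X₂/(μn),1)·min(hX₁/(μn),1)·min(hX₂/(μn),1) ] over all P in 𝒫(μ,σ²), with X₁, X₂ i.i.d. with law P, equals min( (μ²+σ²)²/(μ³n), 1 ) if h ≤ μ²n/(μ²+σ²), and equals μn/h² if h ≥ μ²n/(μ²+σ²); moreover the supremum is attained. -/
open MeasureTheory

/-- A nonnegative kernel dominated by `K * G x * G y` has double integral at most `K * (∫ G)²`. -/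
theorem integral_integral_le_mul_sq {P : Measure ℝ} {F : ℝ → ℝ → ℝ} {G : ℝ → ℝ} {K I : ℝ}
    (hx : ∀ᵐ x ∂P, 0 ≤ x) (hG : Integrable G P) (hI : ∫ x, G x ∂P = I)
    (hF : ∀ x y, 0 ≤ x → 0 ≤ y → 0 ≤ F x y)
    (hle : ∀ x y, 0 ≤ x → 0 ≤ y → F x y ≤ K * G x * G y) :
    ∫ x, ∫ y, F x y ∂P ∂P ≤ K * I ^ 2 := by
  calc ∫ x, ∫ y, F x y ∂P ∂P ≤ ∫ x, K * I * G x ∂P := by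
        refine integral_mono_of_nonneg ?_ (hG.const_mul _) ?_
        · filter_upwards [hx] with x h0
          refine integral_nonneg_of_ae ?_
          filter_upwards [hx] with y h1 using hF x y h0 h1
        · filter_upwards [hx] with x h0
          calc ∫ y, F x y ∂P ≤ ∫ y, K * G x * G y ∂P := by
                refine integral_mono_of_nonneg ?_ (hG.const_mul _) ?_
                · filter_upwards [hx] with y h1 using hF x y h0 h1
                · filter_upwards [hx] with y h1 using hle x y h0 h1
            _ = K * I * G x := by rw [integral_const_mul, hI]; ring
    _ = K * I ^ 2 := by rw [integral_const_mul, hI]; ring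

/-- The law with mass `p` at `z` and mass `1 - p` at `0`. -/
noncomputable def twoPointLaw (p z : ℝ) : Measure ℝ :=
  ENNReal.ofReal p • Measure.dirac z + ENNReal.ofReal (1 - p) • Measure.dirac 0

theorem isProbabilityMeasure_twoPointLaw {p : ℝ} (z : ℝ) (h0 : 0 ≤ p) (h1 : p ≤ 1) :
    IsProbabilityMeasure (twoPointLaw p z) := by
  constructor
  simp [twoPointLaw, ← ENNReal.ofReal_add h0 (sub_nonneg.2 h1)]

theorem integral_twoPointLaw {p : ℝ} (z : ℝ) (h0 : 0 ≤ p) (f : ℝ → ℝ) (hf : f 0 = 0) :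
    ∫ x, f x ∂(twoPointLaw p z) = p * f z := by
  have hi (c a : ℝ) : Integrable f (ENNReal.ofReal c • Measure.dirac a) :=
    (integrable_dirac (by simp)).smul_measure ENNReal.ofReal_ne_top
  rw [twoPointLaw, integral_add_measure (hi _ _) (hi _ _), integral_smul_measure,
    integral_smul_measure, integral_dirac, integral_dirac, hf, ENNReal.toReal_ofReal h0]
  simp

theorem twoPointLaw_compl_Icc (p : ℝ) {z c : ℝ} (h0 : 0 ≤ z) (h1 : z ≤ c) :
    twoPointLaw p z (Set.Icc 0 c)ᶜ = 0 := by
  simp [twoPointLaw, h0, h1, h0.trans h1]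

/-- The two-point law on `{0, M / μ}` with mean `μ` and second moment `M` is admissible, and its
clustering functional is explicit. -/
theorem exists_measure_clustering_eq {n μ h c M : ℝ} (hμ : 0 < μ) (hM : μ ^ 2 ≤ M)
    (hc : M / μ ≤ c) :
    ∃ P : Measure ℝ, IsProbabilityMeasure P ∧
      P (Set.Icc 0 c)ᶜ = 0 ∧ (∫ x, x ∂P) = μ ∧ (∫ x, x ^ 2 ∂P) = M ∧
      (n ^ 2 / h ^ 2) * (μ ^ 2 / M) ^ 2 * (min (M / μ * (M / μ) / (μ * n)) 1 *
          min (h * (M / μ) / (μ * n)) 1 ^ 2) = (n ^ 2 / h ^ 2) *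
        ∫ x, ∫ y, min (x * y / (μ * n)) 1 * min (h * x / (μ * n)) 1 *
          min (h * y / (μ * n)) 1 ∂P ∂P := by
  have hM0 : 0 < M := (pow_pos hμ 2).trans_le hM
  have hp : 0 ≤ μ ^ 2 / M := by positivity
  refine ⟨twoPointLaw (μ ^ 2 / M) (M / μ),
    isProbabilityMeasure_twoPointLaw _ hp ((div_le_one hM0).2 hM),
    twoPointLaw_compl_Icc _ (by positivity) hc, ?_, ?_, ?_⟩
  · rw [integral_twoPointLaw _ hp (fun x => x) rfl]
    field_simp
  · rw [integral_twoPointLaw _ hp (fun x => x ^ 2) (by simp)]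
    field_simp
  · rw [integral_twoPointLaw _ hp _ (by simp), integral_twoPointLaw _ hp _ (by simp)]
    ring


/-- With `σ² < μ·max(√(μn), μn/h) − μ²` and `h_c ≥ max(√(μn), μn/h)`, the
supremum of the expected local clustering coefficient `c_P(h)` over all probability
measures `P` on `[0, h_c]` with mean `μ` and second moment `μ² + σ²` (and `X₁, X₂`
i.i.d. with law `P`) equals `min((μ²+σ²)²/(μ³n), 1)` for `h ≤ μ²n/(μ²+σ²)` and
`μn/h²` for `h ≥ μ²n/(μ²+σ²)`, and it is attained. -/
theorem robust_clustering_sup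
    (n μ h h_c σ2 : ℝ) (hn : 0 < n) (hμ : 0 < μ) (hμn : μ ≤ n)
    (hh : 0 < h) (hhn : h ≤ n)
    (hhc : max (Real.sqrt (μ * n)) (μ * n / h) ≤ h_c)
    (hσ2 : 0 ≤ σ2)
    (hσ2ub : σ2 < μ * max (Real.sqrt (μ * n)) (μ * n / h) - μ ^ 2) :
    (h ≤ μ ^ 2 * n / (μ ^ 2 + σ2) →
      IsGreatest {r : ℝ | ∃ P : Measure ℝ, IsProbabilityMeasure P ∧
          P (Set.Icc 0 h_c)ᶜ = 0 ∧ (∫ x, x ∂P) = μ ∧ (∫ x, x ^ 2 ∂P) = μ ^ 2 + σ2 ∧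
          r = (n ^ 2 / h ^ 2) *
            ∫ x, ∫ y, min (x * y / (μ * n)) 1 * min (h * x / (μ * n)) 1 *
              min (h * y / (μ * n)) 1 ∂P ∂P}
        (min ((μ ^ 2 + σ2) ^ 2 / (μ ^ 3 * n)) 1)) ∧
    (μ ^ 2 * n / (μ ^ 2 + σ2) ≤ h →
      IsGreatest {r : ℝ | ∃ P : Measure ℝ, IsProbabilityMeasure P ∧
          P (Set.Icc 0 h_c)ᶜ = 0 ∧ (∫ x, x ∂P) = μ ∧ (∫ x, x ^ 2 ∂P) = μ ^ 2 + σ2 ∧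
          r = (n ^ 2 / h ^ 2) *
            ∫ x, ∫ y, min (x * y / (μ * n)) 1 * min (h * x / (μ * n)) 1 *
              min (h * y / (μ * n)) 1 ∂P ∂P}
        (μ * n / h ^ 2)) := by
  have hm : 0 < μ * n := by positivity
  have hM : μ ^ 2 ≤ μ ^ 2 + σ2 := by linarith
  have hMpos : 0 < μ ^ 2 + σ2 := by positivity
  have hMlt : (μ ^ 2 + σ2) / μ < max (Real.sqrt (μ * n)) (μ * n / h) := by
    rw [div_lt_iff₀ hμ]; linarith
  obtain ⟨P₀, h1, h2, h3, h4, h5⟩ :=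
    exists_measure_clustering_eq (n := n) (h := h) hμ hM (hMlt.le.trans hhc)
  generalize hMdef : μ ^ 2 + σ2 = M at *
  have hmem {P : Measure ℝ} (hP : P (Set.Icc 0 h_c)ᶜ = 0) : ∀ᵐ x ∂P, 0 ≤ x := by
    filter_upwards [compl_mem_ae_iff.2 hP] with x hx
    exact (not_not.1 hx).1
  have hF (x y : ℝ) (hx : 0 ≤ x) (hy : 0 ≤ y) : 0 ≤ min (x * y / (μ * n)) 1 *
      min (h * x / (μ * n)) 1 * min (h * y / (μ * n)) 1 := by positivity
  have hint {P : Measure ℝ} {G : ℝ → ℝ} {I : ℝ} (hI : ∫ x, G x ∂P = I) (h0 : 0 < I) :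
      Integrable G P := by
    by_contra hG
    rw [integral_undef hG] at hI
    exact h0.ne hI
  constructor
  · intro hle
    have hz : h * (M / μ) / (μ * n) ≤ 1 := by
      rw [le_div_iff₀ hMpos] at hle
      rw [div_le_one hm, mul_div_assoc', div_le_iff₀ hμ]
      linarith
    refine ⟨⟨P₀, h1, h2, h3, h4, ?_⟩, ?_⟩
    · rw [← h5, min_eq_left hz]
      have : M / μ * (M / μ) / (μ * n) = M ^ 2 / (μ ^ 3 * n) := by field_simp
      rw [this]
      field_simp
    · rintro r ⟨P, hP, hPs, hP1, hP2, rfl⟩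
      refine le_min ?_ ?_
      · have := integral_integral_le_mul_sq (K := h ^ 2 / (μ * n) ^ 3) (hmem hPs)
          (hint hP2 hMpos) hP2 hF (fun x y hx hy => by
            calc _ ≤ x * y / (μ * n) * (h * x / (μ * n)) * (h * y / (μ * n)) := by
                  gcongr <;> exact min_le_left _ _
              _ = _ := by ring)
        calc _ ≤ n ^ 2 / h ^ 2 * (h ^ 2 / (μ * n) ^ 3 * M ^ 2) := by gcongr
          _ = _ := by field_simp
      · have := integral_integral_le_mul_sq (K := h ^ 2 / (μ * n) ^ 2) (hmem hPs)
          (hint hP1 hμ) hP1 hF (fun x y hx hy => by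
            calc _ ≤ 1 * (h * x / (μ * n)) * (h * y / (μ * n)) := by
                  gcongr
                  · exact min_le_right _ _
                  · exact min_le_left _ _
                  · exact min_le_left _ _
              _ = _ := by ring)
        calc _ ≤ n ^ 2 / h ^ 2 * (h ^ 2 / (μ * n) ^ 2 * μ ^ 2) := by gcongr
          _ = _ := by field_simp
  · intro hle
    have hb : μ * n / h ≤ M / μ := by
      rw [div_le_iff₀ hMpos] at hle
      rw [div_le_div_iff₀ hh hμ]
      linarith
    have hz : 1 ≤ h * (M / μ) / (μ * n) := by
      rw [div_le_iff₀ hh] at hb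
      rw [le_div_iff₀ hm]
      linarith
    have hs : M / μ < Real.sqrt (μ * n) := (lt_max_iff.1 hMlt).resolve_right hb.not_gt
    have hq : M / μ * (M / μ) / (μ * n) ≤ 1 := by
      rw [div_le_one hm, ← sq]
      exact ((Real.lt_sqrt (by positivity)).1 hs).le
    refine ⟨⟨P₀, h1, h2, h3, h4, ?_⟩, ?_⟩
    · rw [← h5, min_eq_right hz, min_eq_left hq]
      field_simp
    · rintro r ⟨P, hP, hPs, hP1, hP2, rfl⟩
      have := integral_integral_le_mul_sq (K := 1 / (μ * n)) (hmem hPs)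
        (hint hP1 hμ) hP1 hF (fun x y hx hy => by
          calc _ ≤ x * y / (μ * n) * 1 * 1 := by
                gcongr
                · exact min_le_left _ _
                · exact min_le_right _ _
                · exact min_le_right _ _
            _ = _ := by ring)
      calc _ ≤ n ^ 2 / h ^ 2 * (1 / (μ * n) * μ ^ 2) := by gcongr
        _ = _ := by field_simp
end

section
/- Let k ≥ 3 be an integer, let s > 0, and let x₁, …, x_k ≥ 0. Then ∏_{1 ≤ i < j ≤ k} min(xᵢxⱼ/s, 1) ≤ (∏_{i=1}^k xᵢ²) / s^k. -/
/-- The edge `{i, i + 1}` of the Hamilton cycle `0, 1, …, n + 2`, as an increasing pair. -/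
def cycleEdge {n : ℕ} (i : Fin (n + 3)) : (_ : Fin (n + 3)) × Fin (n + 3) :=
  ⟨min i (i + 1), max i (i + 1)⟩

lemma cycleEdge_injective {n : ℕ} : Function.Injective (cycleEdge (n := n)) := by
  intro i j h
  simp only [cycleEdge, Sigma.mk.injEq, heq_eq_eq, Fin.ext_iff, Fin.coe_min, Fin.coe_max,
    Fin.val_add_one, Fin.val_last] at h
  ext
  split_ifs at h <;> omega

lemma cycleEdge_fst_lt_snd {n : ℕ} (i : Fin (n + 3)) : (cycleEdge i).1 < (cycleEdge i).2 :=
  min_lt_max.2 (by simp)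

/-- For `k ≥ 3`, `s > 0` and nonnegative `x₁, …, x_k`,
`∏_{i<j} min(xᵢxⱼ/s, 1) ≤ (∏ i, xᵢ²) / s^k`. -/
theorem clique_dual_feasibility
    (k : ℕ) (hk : 3 ≤ k) (s : ℝ) (hs : 0 < s)
    (x : Fin k → ℝ) (hx : ∀ i, 0 ≤ x i) :
    (∏ i : Fin k, ∏ j ∈ Finset.Ioi i, min (x i * x j / s) 1)
      ≤ (∏ i : Fin k, x i ^ 2) / s ^ k := by
  obtain ⟨n, rfl⟩ := Nat.exists_eq_add_of_le' hk
  have hm (i j : Fin (n + 3)) : 0 ≤ min (x i * x j / s) 1 :=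
    le_min (div_nonneg (mul_nonneg (hx i) (hx j)) hs.le) zero_le_one
  have hsub : Finset.univ.image cycleEdge ⊆
      Finset.univ.sigma fun i : Fin (n + 3) => Finset.Ioi i := by
    intro p hp
    obtain ⟨i, -, rfl⟩ := Finset.mem_image.1 hp
    simpa using cycleEdge_fst_lt_snd i
  have hshift : ∏ i, x (i + 1) = ∏ i, x i := Equiv.prod_comp (Equiv.addRight 1) x
  rw [Finset.prod_sigma', ← Finset.prod_sdiff hsub]
  calc
    _ ≤ ∏ p ∈ Finset.univ.image cycleEdge, min (x p.1 * x p.2 / s) 1 :=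
      mul_le_of_le_one_left (Finset.prod_nonneg fun _ _ => hm _ _)
        (Finset.prod_le_one (fun _ _ => hm _ _) fun _ _ => min_le_right _ _)
    _ = ∏ i, min (x (cycleEdge i).1 * x (cycleEdge i).2 / s) 1 :=
      Finset.prod_image cycleEdge_injective.injOn
    _ ≤ ∏ i, x i * x (i + 1) / s := by
      refine Finset.prod_le_prod (fun _ _ => hm _ _) fun i _ => (min_le_left _ _).trans_eq ?_
      rcases le_total i (i + 1) with h | h <;> simp [cycleEdge, h, mul_comm]
    _ = (∏ i, x i ^ 2) / s ^ (n + 3) := by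
      simp [Finset.prod_div_distrib, Finset.prod_mul_distrib, hshift, sq]
end

section
/- Let n, μ, h, h_c > 0 with h ≤ n, set l = min(μn/h, h_c), and assume μ ≤ l. Then for all x ∈ [0, h_c], x·min(hx/(μn), 1) ≤ (hl/(2μn))·|x − μ| + (hl/(2μn) + h/n)·x − hl/(2n). -/
/-- The pointwise majorant inequality for the MAD-based maximization of
the average neighbor degree: for all `x ∈ [0, h_c]`, with `l = min(μn/h, h_c)` and
`μ ≤ l`,
`x min(hx/(μn), 1) ≤ (hl/(2μn)) |x − μ| + (hl/(2μn) + h/n) x − hl/(2n)`. -/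
theorem mad_dual_majorant
    (n μ h h_c l : ℝ) (hn : 0 < n) (hμ : 0 < μ) (hh : 0 < h) (hhc : 0 < h_c)
    (hhn : h ≤ n) (hl : l = min (μ * n / h) h_c) (hμl : μ ≤ l) :
    ∀ x ∈ Set.Icc (0 : ℝ) h_c,
      x * min (h * x / (μ * n)) 1
        ≤ (h * l / (2 * μ * n)) * |x - μ| + (h * l / (2 * μ * n) + h / n) * x
          - h * l / (2 * n) := by
  rintro x ⟨hx0, hxc⟩
  obtain ⟨a, ha⟩ : ∃ a, a = h / (μ * n) := ⟨_, rfl⟩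
  have ha0 : 0 < a := by rw [ha]; positivity
  have hmin : min (h * x / (μ * n)) 1 = min (a * x) 1 := by
    rw [ha, div_mul_eq_mul_div]
  have hslope : h * l / (2 * μ * n) = a * l / 2 := by rw [ha]; field_simp
  have hdiv : h / n = a * μ := by rw [ha]; field_simp
  have hconst : h * l / (2 * n) = a * μ * l / 2 := by rw [ha]; field_simp
  rw [hmin, hslope, hdiv, hconst]
  have hquad : x * min (a * x) 1 ≤ x * (a * x) :=
    mul_le_mul_of_nonneg_left (min_le_left _ _) hx0
  have hlin : x * min (a * x) 1 ≤ x * 1 :=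
    mul_le_mul_of_nonneg_left (min_le_right _ _) hx0
  rcases le_total x μ with hxμ | hμx
  · rw [abs_of_nonpos (sub_nonpos.2 hxμ)]
    nlinarith [mul_nonneg (mul_nonneg ha0.le hx0) (sub_nonneg.2 hxμ)]
  · rw [abs_of_nonneg (sub_nonneg.2 hμx)]
    rcases le_or_gt x l with hxl | hlx
    · nlinarith [mul_nonneg ha0.le (mul_nonneg (sub_nonneg.2 hμx) (sub_nonneg.2 hxl))]
    · have hl_eq : l = μ * n / h := by
        rcases min_choice (μ * n / h) h_c with hm | hm
        · exact hl.trans hm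
        · linarith [hl.trans hm]
      have hal : a * l = 1 := by rw [ha, hl_eq]; field_simp
      have hgap : 0 ≤ a * μ * (x - l) :=
        mul_nonneg (mul_nonneg ha0.le hμ.le) (sub_nonneg.2 hlx.le)
      have hmul : a * μ * l = μ := by rw [mul_right_comm, hal, one_mul]
      rw [hal]
      linarith
end

section
/- Let n, μ, h, h_c > 0 with h ≤ n, set l = min(μn/h, h_c), assume μ ≤ l, and let d ≥ 0. Then for every probability measure P on [0, h_c] with ∫x dP = μ and ∫|x − μ| dP = d, one has a_P(h) = (n/h)·∫ x·min(hx/(μn), 1) dP(x) ≤ μ + d·l/(2μ). -/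
open MeasureTheory

/-- The truncated quadratic `x min(x, L)` lies below the function of the form
`a + b x + c |x - μ|` that meets it at `0`, `μ` and `l`. -/
lemma mul_min_le_affine_add_abs {μ l L x : ℝ} (hμ : 0 < μ) (hx : 0 ≤ x)
    (hl : x ≤ l ∨ L = l) :
    x * min x L ≤ μ ^ 2 + (μ + l / 2) * (x - μ) + l / 2 * |x - μ| := by
  rcases le_total x μ with h | h
  · rw [abs_of_nonpos (by linarith)]
    nlinarith [mul_le_mul_of_nonneg_left (min_le_left x L) hx, mul_nonneg hx (sub_nonneg.2 h)]
  · rw [abs_of_nonneg (by linarith)]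
    rcases le_total x l with hxl | hxl
    · nlinarith [mul_le_mul_of_nonneg_left (min_le_left x L) hx,
        mul_nonneg (sub_nonneg.2 h) (sub_nonneg.2 hxl)]
    · have hmin : min x L ≤ l := by
        rcases hl with hl | hl
        · exact (min_le_left _ _).trans hl
        · exact (min_le_right _ _).trans hl.le
      nlinarith [mul_le_mul_of_nonneg_left hmin hx, mul_nonneg hμ.le (sub_nonneg.2 hxl)]

/-- For every probability measure `P` on `[0, h_c]` with mean `μ` and
mean absolute deviation `d`, the expected average neighbor degree satisfies
`a_P(h) = (n/h) ∫ x min(hx/(μn), 1) dP(x) ≤ μ + d l/(2μ)` with `l = min(μn/h, h_c)`. -/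
theorem robust_annd_mad_bound
    (n μ h h_c l d : ℝ) (hn : 0 < n) (hμ : 0 < μ) (hh : 0 < h) (hhc : 0 < h_c)
    (hhn : h ≤ n) (hl : l = min (μ * n / h) h_c) (hμl : μ ≤ l) (hd : 0 ≤ d)
    (P : Measure ℝ) [IsProbabilityMeasure P]
    (hsupp : P (Set.Icc 0 h_c)ᶜ = 0)
    (hmean : ∫ x, x ∂P = μ)
    (hmad : ∫ x, |x - μ| ∂P = d) :
    (n / h) * ∫ x, x * min (h * x / (μ * n)) 1 ∂P ≤ μ + d * l / (2 * μ) := by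
  have hae : ∀ᵐ x ∂P, x ∈ Set.Icc 0 h_c := hsupp
  have hid : Integrable (fun x : ℝ => x) P :=
    Integrable.of_bound measurable_id.aestronglyMeasurable h_c <| by
      filter_upwards [hae] with x hx
      simpa [abs_of_nonneg hx.1] using hx.2
  have hsub : Integrable (fun x : ℝ => x - μ) P := hid.sub (integrable_const μ)
  have hlin : Integrable (fun x : ℝ => μ ^ 2 + (μ + l / 2) * (x - μ)) P :=
    (integrable_const _).add (hsub.const_mul _)
  have habs : Integrable (fun x : ℝ => l / 2 * |x - μ|) P := hsub.abs.const_mul _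
  have hF : ∫ x, (μ ^ 2 + (μ + l / 2) * (x - μ) + l / 2 * |x - μ|) ∂P = μ ^ 2 + l / 2 * d := by
    rw [integral_add hlin habs, integral_add (integrable_const _) (hsub.const_mul _),
      integral_const_mul, integral_const_mul, integral_sub hid (integrable_const _), hmean, hmad]
    simp
  have hscale (x : ℝ) : n / h * (x * min (h * x / (μ * n)) 1)
      = μ⁻¹ * (x * min x (μ * n / h)) := by
    have hmin : min x (μ * n / h) = μ * n / h * min (h * x / (μ * n)) 1 := by
      rw [mul_min_of_nonneg _ _ (by positivity)]
      congr 1 <;> field_simp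
    rw [hmin]
    field_simp
  have hbound : ∫ x, x * min x (μ * n / h) ∂P ≤ μ ^ 2 + l / 2 * d := by
    rw [← hF]
    refine integral_mono_of_nonneg ?_ (hlin.add habs) ?_
    · filter_upwards [hae] with x hx
      exact mul_nonneg hx.1 (le_min hx.1 (by positivity))
    · filter_upwards [hae] with x hx
      refine mul_min_le_affine_add_abs hμ hx.1 ?_
      rcases min_choice (μ * n / h) h_c with hc | hc
      · exact Or.inr (hl.trans hc).symm
      · exact Or.inl (hx.2.trans (hl.trans hc).ge)
  calc (n / h) * ∫ x, x * min (h * x / (μ * n)) 1 ∂P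
      = μ⁻¹ * ∫ x, x * min x (μ * n / h) ∂P := by
        simp_rw [← integral_const_mul, hscale]
    _ ≤ μ⁻¹ * (μ ^ 2 + l / 2 * d) := by gcongr
    _ = μ + d * l / (2 * μ) := by field_simp
end

section
/- Let n, μ, h, h_c > 0 with h ≤ n, set l = min(μn/h, h_c), and assume μ < l, d ≥ 0, and d/(2μ) + d/(2(l−μ)) ≤ 1. Then the supremum of a_P(h) = (n/h)·∫ x·min(hx/(μn), 1) dP(x) over all probability measures P in 𝒫(μ,d) equals μ + d·l/(2μ), and the supremum is attained by a three-point distribution supported on {0, μ, l}. -/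
open MeasureTheory

/-- On `[0, h_c]` the rescaled integrand lies below the piecewise linear function with kink at `μ`
that agrees with it at `0`, `μ` and `l`. -/
theorem annd_integrand_le {n μ h h_c l x : ℝ} (hn : 0 < n) (hμ : 0 < μ) (hh : 0 < h)
    (hl : l = min (μ * n / h) h_c) (hx0 : 0 ≤ x) (hxc : x ≤ h_c) :
    (n / h) * (x * min (h * x / (μ * n)) 1) ≤
      -(l / 2) + (1 + l / (2 * μ)) * x + l / (2 * μ) * |x - μ| := by
  have hquad : (n / h) * (x * min (h * x / (μ * n)) 1) ≤ x ^ 2 / μ := by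
    calc (n / h) * (x * min (h * x / (μ * n)) 1)
        ≤ (n / h) * (x * (h * x / (μ * n))) := by gcongr; exact min_le_left _ _
      _ = x ^ 2 / μ := by field_simp
  rcases le_total x μ with hxμ | hxμ
  · have hrhs : -(l / 2) + (1 + l / (2 * μ)) * x + l / (2 * μ) * |x - μ| = x := by
      rw [abs_of_nonpos (by linarith)]
      field_simp
      ring
    rw [hrhs]
    refine hquad.trans ?_
    rw [div_le_iff₀ hμ]
    nlinarith
  · have hrhs : -(l / 2) + (1 + l / (2 * μ)) * x + l / (2 * μ) * |x - μ|
        = ((μ + l) * x - l * μ) / μ := by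
      rw [abs_of_nonneg (by linarith)]
      field_simp
      ring
    rw [hrhs]
    rcases le_or_gt x l with hxl | hxl
    · refine hquad.trans ?_
      gcongr
      nlinarith [mul_nonneg (sub_nonneg.2 hxμ) (sub_nonneg.2 hxl)]
    · have hlL : l = μ * n / h := by
        rcases min_choice (μ * n / h) h_c with hm | hm <;> rw [hm] at hl <;> linarith
      calc (n / h) * (x * min (h * x / (μ * n)) 1)
          ≤ (n / h) * (x * 1) := by gcongr; exact min_le_right _ _
        _ = l * x / μ := by rw [hlL]; field_simp
        _ ≤ ((μ + l) * x - l * μ) / μ := by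
          gcongr
          nlinarith

/-- The measure with masses `a`, `b`, `c` at the points `x`, `y`, `z`. -/
noncomputable def threePoint (a b c x y z : ℝ) : Measure ℝ :=
  ENNReal.ofReal a • Measure.dirac x + ENNReal.ofReal b • Measure.dirac y
    + ENNReal.ofReal c • Measure.dirac z

theorem integral_threePoint {a b c : ℝ} (ha : 0 ≤ a) (hb : 0 ≤ b) (hc : 0 ≤ c) (x y z : ℝ)
    (f : ℝ → ℝ) : ∫ t, f t ∂(threePoint a b c x y z) = a * f x + b * f y + c * f z := by
  have hi : ∀ r w : ℝ, Integrable f (ENNReal.ofReal r • Measure.dirac w) := fun r w =>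
    (integrable_dirac (by simp)).smul_measure ENNReal.ofReal_ne_top
  rw [threePoint, integral_add_measure ((hi a x).add_measure (hi b y)) (hi c z),
    integral_add_measure (hi a x) (hi b y)]
  simp [integral_smul_measure, ha, hb, hc]

theorem threePoint_isProbabilityMeasure {a b c : ℝ} (ha : 0 ≤ a) (hb : 0 ≤ b) (hc : 0 ≤ c)
    (habc : a + b + c = 1) (x y z : ℝ) : IsProbabilityMeasure (threePoint a b c x y z) := by
  constructor
  simp [threePoint, ← ENNReal.ofReal_add, ha, hb, hc, add_nonneg, habc]

theorem threePoint_compl_eq_zero {x y z : ℝ} {s : Set ℝ} (hs : MeasurableSet s) (a b c : ℝ)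
    (hx : x ∈ s) (hy : y ∈ s) (hz : z ∈ s) : threePoint a b c x y z sᶜ = 0 := by
  simp [threePoint, Measure.dirac_apply' _ hs.compl, hx, hy, hz]

/-- With `l = min(μn/h, h_c)`, `μ < l` and `d/(2μ) + d/(2(l−μ)) ≤ 1`,
the supremum of `a_P(h)` over all probability measures `P` on `[0, h_c]` with mean `μ`
and mean absolute deviation `d` equals `μ + d l/(2μ)`, attained by a three-point
distribution supported on `{0, μ, l}`. -/
theorem robust_annd_mad_sup
    (n μ h h_c l d : ℝ) (hn : 0 < n) (hμ : 0 < μ) (hh : 0 < h) (hhc : 0 < h_c)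
    (hhn : h ≤ n) (hl : l = min (μ * n / h) h_c) (hμl : μ < l) (hd : 0 ≤ d)
    (hdub : d / (2 * μ) + d / (2 * (l - μ)) ≤ 1) :
    (∀ P : Measure ℝ, IsProbabilityMeasure P → P (Set.Icc 0 h_c)ᶜ = 0 →
        (∫ x, x ∂P) = μ → (∫ x, |x - μ| ∂P) = d →
        (n / h) * ∫ x, x * min (h * x / (μ * n)) 1 ∂P ≤ μ + d * l / (2 * μ)) ∧
    (∃ P : Measure ℝ, IsProbabilityMeasure P ∧ P (Set.Icc 0 h_c)ᶜ = 0 ∧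
        (∫ x, x ∂P) = μ ∧ (∫ x, |x - μ| ∂P) = d ∧
        P (({0, μ, l} : Set ℝ))ᶜ = 0 ∧
        (n / h) * ∫ x, x * min (h * x / (μ * n)) 1 ∂P = μ + d * l / (2 * μ)) := by
  refine ⟨fun P hP hsupp hmean hmad => ?_, ?_⟩
  · have hid : Integrable (fun x : ℝ => x) P :=
      Integrable.of_integral_ne_zero (by rw [hmean]; exact hμ.ne')
    have habs : Integrable (fun x : ℝ => |x - μ|) P := (hid.sub (integrable_const μ)).abs
    have hmem : ∀ᵐ x ∂P, x ∈ Set.Icc 0 h_c := mem_ae_iff.2 hsupp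
    have hlin : Integrable (fun x : ℝ => -(l / 2) + (1 + l / (2 * μ)) * x) P :=
      (integrable_const _).add (hid.const_mul _)
    rw [← integral_const_mul]
    calc ∫ x, (n / h) * (x * min (h * x / (μ * n)) 1) ∂P
        ≤ ∫ x, (-(l / 2) + (1 + l / (2 * μ)) * x + l / (2 * μ) * |x - μ|) ∂P := by
          refine integral_mono_of_nonneg ?_ (hlin.add (habs.const_mul _)) ?_
          · filter_upwards [hmem] with x hx
            have hx0 := hx.1
            simp only [Pi.zero_apply]
            positivity
          · filter_upwards [hmem] with x hx
            exact annd_integrand_le hn hμ hh hl hx.1 hx.2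
      _ = μ + d * l / (2 * μ) := by
          rw [integral_add hlin (habs.const_mul _),
            integral_add (integrable_const _) (hid.const_mul _), integral_const_mul,
            integral_const_mul, hmean, hmad]
          simp
          field_simp
          ring
  · have hlμ : 0 < l - μ := sub_pos.2 hμl
    have hl0 : 0 < l := hμ.trans hμl
    have hlL : l ≤ μ * n / h := hl ▸ min_le_left _ _
    have hlc : l ≤ h_c := hl ▸ min_le_right _ _
    have ha : 0 ≤ d / (2 * μ) := by positivity
    have hc : 0 ≤ d / (2 * (l - μ)) := by positivity
    have hb : 0 ≤ 1 - d / (2 * μ) - d / (2 * (l - μ)) := by linarith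
    refine ⟨threePoint (d / (2 * μ)) (1 - d / (2 * μ) - d / (2 * (l - μ))) (d / (2 * (l - μ))) 0 μ l,
      threePoint_isProbabilityMeasure ha hb hc (by ring) _ _ _,
      threePoint_compl_eq_zero measurableSet_Icc _ _ _ ⟨le_rfl, hhc.le⟩
        ⟨hμ.le, hμl.le.trans hlc⟩ ⟨hl0.le, hlc⟩, ?_, ?_,
      threePoint_compl_eq_zero (Set.toFinite _).measurableSet _ _ _ (by simp) (by simp) (by simp),
      ?_⟩
    · rw [integral_threePoint ha hb hc]
      field_simp
      ring
    · rw [integral_threePoint ha hb hc, zero_sub, abs_neg, abs_of_pos hμ, sub_self, abs_zero,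
        abs_of_pos hlμ]
      field_simp
      ring
    · have hmin : ∀ x ≤ l, min (h * x / (μ * n)) 1 = h * x / (μ * n) := fun x hx => by
        refine min_eq_left ?_
        rw [div_le_one (by positivity), mul_comm h x]
        exact (le_div_iff₀ hh).1 (hx.trans hlL)
      rw [integral_threePoint ha hb hc, hmin 0 hl0.le, hmin μ hμl.le, hmin l le_rfl]
      field_simp
      ring
end

section
/- Let n, μ > 0 with √(μn) ≤ h ≤ n, set l = μn/h, assume μ < l, d ≥ 0, and d/(2μ) + d/(2(l−μ)) ≤ 1. Let P* be the discrete measure placing mass d/(2μ) at 0, mass d/(2(l−μ)) at l, and mass 1 − d/(2μ) − d/(2(l−μ)) at μ. Then P* is a probability measure with mean μ and mean absolute deviation ∫|x−μ| dP* = d, and for X₁, X₂ i.i.d. with law P*, E[ min(X₁X₂/(μn),1)·min(hX₁/(μn),1)·min(hX₂/(μn),1) ] = (dn + 2hμ)² / (4μn³), so that c_{P*}(h) = (dn + 2hμ)² / (4μh²n). -/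
open MeasureTheory

theorem integral_three_smul_dirac {α : Type*} [MeasurableSpace α] [MeasurableSingletonClass α]
    {p q r : ℝ} (hp : 0 ≤ p) (hq : 0 ≤ q) (hr : 0 ≤ r) (a b c : α) (f : α → ℝ) :
    ∫ x, f x ∂(ENNReal.ofReal p • Measure.dirac a + ENNReal.ofReal q • Measure.dirac b
      + ENNReal.ofReal r • Measure.dirac c) = p * f a + q * f b + r * f c := by
  have hi (s : ℝ) (e : α) : Integrable f (ENNReal.ofReal s • Measure.dirac e) :=
    (integrable_dirac enorm_lt_top).smul_measure ENNReal.ofReal_ne_top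
  rw [integral_add_measure ((hi p a).add_measure (hi q b)) (hi r c),
    integral_add_measure (hi p a) (hi q b)]
  simp [integral_smul_measure, ENNReal.toReal_ofReal, hp, hq, hr]

/-- For `√(μn) ≤ h ≤ n`, `l = μn/h`, `μ < l` and
`d/(2μ) + d/(2(l−μ)) ≤ 1`, the three-point distribution with mass `d/(2μ)` at `0`,
mass `d/(2(l−μ))` at `l` and the remaining mass at `μ` is a probability measure with
mean `μ` and mean absolute deviation `d`, and for `X₁, X₂` i.i.d. with this law, the
triangle probability equals `(dn + 2hμ)²/(4μn³)`, so that
`c_{P*}(h) = (dn + 2hμ)²/(4μh²n)`. -/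
theorem three_point_attains_clustering_mad_high_h
    (n μ h l d : ℝ) (hn : 0 < n) (hμ : 0 < μ)
    (hhs : Real.sqrt (μ * n) ≤ h) (hhn : h ≤ n)
    (hl : l = μ * n / h) (hμl : μ < l) (hd : 0 ≤ d)
    (hdub : d / (2 * μ) + d / (2 * (l - μ)) ≤ 1)
    (P : Measure ℝ)
    (hP : P = ENNReal.ofReal (d / (2 * μ)) • Measure.dirac (0 : ℝ)
        + ENNReal.ofReal (d / (2 * (l - μ))) • Measure.dirac l
        + ENNReal.ofReal (1 - d / (2 * μ) - d / (2 * (l - μ))) • Measure.dirac μ) :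
    IsProbabilityMeasure P ∧
    (∫ x, x ∂P) = μ ∧
    (∫ x, |x - μ| ∂P) = d ∧
    (∫ x, ∫ y, min (x * y / (μ * n)) 1 * min (h * x / (μ * n)) 1 *
        min (h * y / (μ * n)) 1 ∂P ∂P)
      = (d * n + 2 * h * μ) ^ 2 / (4 * μ * n ^ 3) ∧
    (n ^ 2 / h ^ 2) *
        ∫ x, ∫ y, min (x * y / (μ * n)) 1 * min (h * x / (μ * n)) 1 *
          min (h * y / (μ * n)) 1 ∂P ∂P
      = (d * n + 2 * h * μ) ^ 2 / (4 * μ * h ^ 2 * n) := by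
  have hmn : 0 < μ * n := mul_pos hμ hn
  have hh : 0 < h := (Real.sqrt_pos.2 hmn).trans_le hhs
  have hlpos : 0 < l := hμ.trans hμl
  have hlm : 0 < l - μ := sub_pos.2 hμl
  have hlh : h * l = μ * n := by rw [hl]; field_simp
  have hle : l ≤ h := by
    have h2 := (Real.sqrt_le_left hh.le).1 hhs
    by_contra! hlt
    nlinarith
  have hp : 0 ≤ d / (2 * μ) := by positivity
  have hq : 0 ≤ d / (2 * (l - μ)) := by positivity
  have hr : 0 ≤ 1 - d / (2 * μ) - d / (2 * (l - μ)) := by linarith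
  have hint (f : ℝ → ℝ) := integral_three_smul_dirac hp hq hr 0 l μ f
  rw [← hP] at hint
  have hmean : d / (2 * (l - μ)) * l + (1 - d / (2 * μ) - d / (2 * (l - μ))) * μ = μ := by
    field_simp
    ring
  have hsecond : d / (2 * (l - μ)) * l ^ 2 + (1 - d / (2 * μ) - d / (2 * (l - μ))) * μ ^ 2
      = μ ^ 2 + d * l / 2 := by
    field_simp
    ring
  have hmin {x y : ℝ} (hy : 0 ≤ y) (hx : x ≤ h) (hyl : y ≤ l) :
      min (x * y / (μ * n)) 1 = x * y / (μ * n) := by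
    refine min_eq_left ((div_le_one hmn).2 ?_)
    rw [← hlh]
    exact mul_le_mul hx hyl hy hh.le
  have htri : (∫ x, ∫ y, min (x * y / (μ * n)) 1 * min (h * x / (μ * n)) 1 *
      min (h * y / (μ * n)) 1 ∂P ∂P) = (d * n + 2 * h * μ) ^ 2 / (4 * μ * n ^ 3) := by
    have hμh : μ ≤ h := hμl.le.trans hle
    simp only [hint, mul_zero, zero_mul, zero_div, min_eq_left zero_le_one, zero_add]
    rw [hmin hlpos.le hle le_rfl, hmin hμ.le hle hμl.le, hmin hlpos.le hμh le_rfl,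
      hmin hμ.le hμh hμl.le, hmin hlpos.le le_rfl le_rfl, hmin hμ.le le_rfl hμl.le]
    calc
      _ = h ^ 2 / (μ * n) ^ 3 * (d / (2 * (l - μ)) * l ^ 2
            + (1 - d / (2 * μ) - d / (2 * (l - μ))) * μ ^ 2) ^ 2 := by ring
      _ = (d * (h * l) + 2 * h * μ ^ 2) ^ 2 / (4 * (μ * n) ^ 3) := by rw [hsecond]; ring
      _ = _ := by rw [hlh]; field_simp
  refine ⟨⟨?_⟩, ?_, ?_, htri, ?_⟩
  · simp only [hP, Measure.coe_add, Measure.coe_smul, Pi.add_apply, Pi.smul_apply,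
      measure_univ, smul_eq_mul, mul_one]
    rw [← ENNReal.ofReal_add hp hq, ← ENNReal.ofReal_add (add_nonneg hp hq) hr,
      ← ENNReal.ofReal_one]
    congr 1
    ring
  · rw [hint]
    linarith
  · rw [hint, zero_sub, abs_neg, abs_of_pos hμ, abs_of_pos hlm, sub_self, abs_zero]
    field_simp
    ring
  · rw [htri]
    field_simp
end
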